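/- Let q be any prime power and F = GF(q). Let y ∈ F^6 be nonzero with rank(M_y) = 3. Then among the conics of the squab S_y there are exactly q+1 double lines, exactly (q^3+2q^2+q)/2 pairs of real lines, exactly (q^3−q)/2 pairs of imaginary lines, and exactly q^4 nonsingular conics. -/

import Mathlib

open Matrix

namespace Conics

/-- Coefficient vector (a0,...,a5) of the product of two linear forms
`(b0*X0+b1*X1+b2*X2)*(c0*X0+c1*X1+c2*X2)`, where the quadratic form with
coefficient vector `a` is `a0*X0^2 + a1*X0*X1 + a2*X0*X2 + a3*X1^2 + a4*X1*X2 + a5*X2^2`. -/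
def mulLin {F : Type} [Field F] (b c : Fin 3 → F) : Fin 6 → F :=
  ![b 0 * c 0, b 0 * c 1 + b 1 * c 0, b 0 * c 2 + b 2 * c 0,
    b 1 * c 1, b 1 * c 2 + b 2 * c 1, b 2 * c 2]

/-- The discriminant of the quadratic form with coefficient vector `a`. -/
def disc {F : Type} [Field F] (a : Fin 6 → F) : F :=
  4 * a 0 * a 3 * a 5 + a 1 * a 2 * a 4 - a 0 * a 4 ^ 2 - a 3 * a 2 ^ 2 - a 5 * a 1 ^ 2

/-- `f_a` is a double line: `f_a = c * l^2` for a nonzero scalar `c` and nonzero linear form `l`. -/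
def IsDoubleLine {F : Type} [Field F] (a : Fin 6 → F) : Prop :=
  ∃ (c : F) (l : Fin 3 → F), c ≠ 0 ∧ l ≠ 0 ∧ a = c • mulLin l l

/-- `f_a` is a pair of (distinct) real lines: `f_a = l1 * l2` with neither linear form a scalar
multiple of the other. -/
def IsRealPair {F : Type} [Field F] (a : Fin 6 → F) : Prop :=
  ∃ l1 l2 : Fin 3 → F, (¬ ∃ t : F, l2 = t • l1) ∧ (¬ ∃ t : F, l1 = t • l2) ∧ a = mulLin l1 l2

/-- `f_a` is a pair of conjugate imaginary lines: singular, but not a product of two linear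
forms over `F`. -/
def IsImagPair {F : Type} [Field F] (a : Fin 6 → F) : Prop :=
  disc a = 0 ∧ ¬ ∃ l1 l2 : Fin 3 → F, a = mulLin l1 l2

/-- `f_a` is a nonsingular conic. -/
def IsNonsingular {F : Type} [Field F] (a : Fin 6 → F) : Prop :=
  disc a ≠ 0

/-- The number of conics of a given type `T` in a linear system `W` (a subspace of the space of
quadratic forms, identified with `F^6`): the number of 1-dimensional subspaces `⟨a⟩` of `W`,
`a ≠ 0`, such that `f_a` has type `T`. -/
noncomputable def numConics {F : Type} [Field F] (W : Submodule F (Fin 6 → F))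
    (T : (Fin 6 → F) → Prop) : ℕ :=
  Set.ncard {P : Submodule F (Fin 6 → F) |
    ∃ a : Fin 6 → F, a ≠ 0 ∧ a ∈ W ∧ T a ∧ P = Submodule.span F {a}}

/-- The symmetric 3×3 matrix associated with a point `y` of `PG(5,q)`. -/
def M {F : Type} [Field F] (y : Fin 6 → F) : Matrix (Fin 3) (Fin 3) F :=
  !![y 0, y 1, y 2; y 1, y 3, y 4; y 2, y 4, y 5]

/-- The pairing `B(a,y) = a0*y0 + ... + a5*y5`. -/
def Bform {F : Type} [Field F] (a y : Fin 6 → F) : F :=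
  a 0 * y 0 + a 1 * y 1 + a 2 * y 2 + a 3 * y 3 + a 4 * y 4 + a 5 * y 5

/-- The squab of conics associated with a (nonzero) point `y`: the hyperplane
`{a : B(a,y) = 0}` of the space of quadratic forms. -/
def squab {F : Type} [Field F] (y : Fin 6 → F) : Submodule F (Fin 6 → F) where
  carrier := {a | Bform a y = 0}
  add_mem' := by
    intro a b ha hb
    simp only [Set.mem_setOf_eq, Bform, Pi.add_apply] at *
    linear_combination ha + hb
  zero_mem' := by simp [Bform]
  smul_mem' := by
    intro c a ha
    simp only [Set.mem_setOf_eq, Bform, Pi.smul_apply, smul_eq_mul] at *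
    linear_combination c * ha

section helpers

variable {F : Type} [Field F]

/-- Bilinear form attached to `y`. -/
def bl (y : Fin 6 → F) (l m : Fin 3 → F) : F := Bform (mulLin l m) y

lemma bl_eq (y : Fin 6 → F) (l m : Fin 3 → F) : bl y l m =
    l 0 * m 0 * y 0 + (l 0 * m 1 + l 1 * m 0) * y 1 + (l 0 * m 2 + l 2 * m 0) * y 2 +
    l 1 * m 1 * y 3 + (l 1 * m 2 + l 2 * m 1) * y 4 + l 2 * m 2 * y 5 := by
  simp [bl, Bform, mulLin]

/-- Determinant of `M y`. -/
def dt (y : Fin 6 → F) : F :=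
  y 0 * y 3 * y 5 + 2 * y 1 * y 2 * y 4 - y 0 * y 4 ^ 2 - y 3 * y 2 ^ 2 - y 5 * y 1 ^ 2

/-- Cross product. -/
def cr (l m : Fin 3 → F) : Fin 3 → F :=
  ![l 1 * m 2 - l 2 * m 1, l 2 * m 0 - l 0 * m 2, l 0 * m 1 - l 1 * m 0]

/-- `v` is a vertex of the conic `a` (in the radical of the quadratic form). -/
def Vtx (a : Fin 6 → F) (v : Fin 3 → F) : Prop :=
  2 * a 0 * v 0 + a 1 * v 1 + a 2 * v 2 = 0 ∧
  a 1 * v 0 + 2 * a 3 * v 1 + a 4 * v 2 = 0 ∧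
  a 2 * v 0 + a 4 * v 1 + 2 * a 5 * v 2 = 0 ∧
  a 0 * v 0 ^ 2 + a 1 * v 0 * v 1 + a 2 * v 0 * v 2 + a 3 * v 1 ^ 2 + a 4 * v 1 * v 2
    + a 5 * v 2 ^ 2 = 0

lemma ext6 {F : Type} {a b : Fin 6 → F} (h0 : a 0 = b 0) (h1 : a 1 = b 1) (h2 : a 2 = b 2)
    (h3 : a 3 = b 3) (h4 : a 4 = b 4) (h5 : a 5 = b 5) : a = b := by
  ext i; fin_cases i <;> assumption

lemma ext3 {F : Type} {a b : Fin 3 → F} (h0 : a 0 = b 0) (h1 : a 1 = b 1) (h2 : a 2 = b 2) : a = b := by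
  ext i; fin_cases i <;> assumption

lemma ne3 {v : Fin 3 → F} (h : v ≠ 0) : v 0 ≠ 0 ∨ v 1 ≠ 0 ∨ v 2 ≠ 0 := by
  by_contra! hh
  exact h (ext3 hh.1 hh.2.1 hh.2.2)

lemma dt_ne (y : Fin 6 → F) (hrk : (M y).rank = 3) : dt y ≠ 0 := by
  intro h
  have hd : (M y).det = 0 := by
    rw [Matrix.det_fin_three]
    simp only [M, Matrix.of_apply, Matrix.cons_val', Matrix.cons_val_zero, Matrix.cons_val_one,
      Matrix.cons_val]
    rw [dt] at h
    linear_combination h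
  obtain ⟨v, hv, hv0⟩ := Matrix.exists_mulVec_eq_zero_iff.mpr hd
  have h1 := LinearMap.finrank_range_add_finrank_ker (M y).mulVecLin
  have h2 : Module.finrank F (LinearMap.range (M y).mulVecLin) = 3 := hrk
  rw [h2] at h1
  simp at h1
  have : v ∈ LinearMap.ker (M y).mulVecLin := by simpa using hv0
  rw [h1] at this
  exact hv (by simpa using this)

lemma bl_nondeg (y : Fin 6 → F) (hy : dt y ≠ 0) (l : Fin 3 → F) (h : ∀ m, bl y l m = 0) :
    l = 0 := by
  have h0 := h ![1, 0, 0]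
  have h1 := h ![0, 1, 0]
  have h2 := h ![0, 0, 1]
  simp [bl_eq] at h0 h1 h2
  refine ext3 ?_ ?_ ?_ <;> apply mul_left_cancel₀ hy <;>
    simp only [dt, Pi.zero_apply, mul_zero]
  · linear_combination (y 3 * y 5 - y 4 ^ 2) * h0 + (y 2 * y 4 - y 1 * y 5) * h1 +
      (y 1 * y 4 - y 2 * y 3) * h2
  · linear_combination (y 2 * y 4 - y 1 * y 5) * h0 + (y 0 * y 5 - y 2 ^ 2) * h1 +
      (y 1 * y 2 - y 0 * y 4) * h2
  · linear_combination (y 1 * y 4 - y 2 * y 3) * h0 + (y 1 * y 2 - y 0 * y 4) * h1 +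
      (y 0 * y 3 - y 1 ^ 2) * h2

lemma cr_eq_zero_iff (l m : Fin 3 → F) (hl : l ≠ 0) : cr l m = 0 ↔ ∃ t : F, m = t • l := by
  constructor
  · intro h
    have h0 := congrFun h 0
    have h1 := congrFun h 1
    have h2 := congrFun h 2
    simp [cr] at h0 h1 h2
    rcases ne3 hl with hl | hl | hl
    · exact ⟨m 0 / l 0, by refine ext3 ?_ ?_ ?_ <;> simp <;> field_simp <;> grind⟩
    · exact ⟨m 1 / l 1, by refine ext3 ?_ ?_ ?_ <;> simp <;> field_simp <;> grind⟩
    · exact ⟨m 2 / l 2, by refine ext3 ?_ ?_ ?_ <;> simp <;> field_simp <;> grind⟩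
  · rintro ⟨t, rfl⟩
    refine ext3 ?_ ?_ ?_ <;> simp [cr] <;> ring

/-- No totally isotropic planes. -/
lemma iso_dep (y : Fin 6 → F) (hy : dt y ≠ 0) (l m : Fin 3 → F) (h1 : bl y l l = 0)
    (h2 : bl y l m = 0) (h3 : bl y m m = 0) : cr l m = 0 := by
  by_contra hc
  have key : ∀ u : Fin 3 → F, (u 0 * cr l m 0 + u 1 * cr l m 1 + u 2 * cr l m 2) ^ 2 * dt y = 0 := by
    intro u
    have : (u 0 * cr l m 0 + u 1 * cr l m 1 + u 2 * cr l m 2) ^ 2 * dt y =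
      bl y u u * (bl y l l * bl y m m - bl y l m ^ 2)
        - bl y u l * (bl y u l * bl y m m - bl y l m * bl y u m)
        + bl y u m * (bl y u l * bl y l m - bl y l l * bl y u m) := by
      simp [cr, dt, bl_eq]
      ring
    rw [this, h1, h2, h3]; ring
  have k0 := key ![1, 0, 0]
  have k1 := key ![0, 1, 0]
  have k2 := key ![0, 0, 1]
  simp [hy] at k0 k1 k2
  exact hc (ext3 k0 k1 k2)

lemma mulLin_eq_zero (c d : Fin 3 → F) (h : mulLin c d = 0) : c = 0 ∨ d = 0 := by
  have h0 := congrFun h 0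
  have h1 := congrFun h 1
  have h2 := congrFun h 2
  have h3 := congrFun h 3
  have h4 := congrFun h 4
  have h5 := congrFun h 5
  simp [mulLin] at h0 h1 h2 h3 h4 h5
  by_contra! hh
  obtain ⟨hc, hd⟩ := hh
  rcases ne3 hc with hc | hc | hc
  · have e0 : d 0 = 0 := by simpa [hc] using h0
    have e1 : d 1 = 0 := by simpa [hc, e0] using h1
    have e2 : d 2 = 0 := by simpa [hc, e0] using h2
    exact hd (ext3 e0 e1 e2)
  · have e0 : d 1 = 0 := by simpa [hc] using h3
    have e1 : d 0 = 0 := by simpa [hc, e0] using h1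
    have e2 : d 2 = 0 := by simpa [hc, e0] using h4
    exact hd (ext3 e1 e0 e2)
  · have e0 : d 2 = 0 := by simpa [hc] using h5
    have e1 : d 0 = 0 := by simpa [hc, e0] using h2
    have e2 : d 1 = 0 := by simpa [hc, e0] using h4
    exact hd (ext3 e1 e2 e0)

lemma mulLin_factor (l m l' m' : Fin 3 → F) (h : mulLin l m = mulLin l' m') :
    cr l' l = 0 ∨ cr l' m = 0 := by
  apply mulLin_eq_zero
  have h0 := congrFun h 0
  have h1 := congrFun h 1
  have h2 := congrFun h 2
  have h3 := congrFun h 3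
  have h4 := congrFun h 4
  have h5 := congrFun h 5
  simp [mulLin] at h0 h1 h2 h3 h4 h5
  refine ext6 ?_ ?_ ?_ ?_ ?_ ?_ <;> simp [mulLin, cr] <;> grind

lemma mulLin_smul_left (t : F) (l m : Fin 3 → F) : mulLin (t • l) m = t • mulLin l m := by
  refine ext6 ?_ ?_ ?_ ?_ ?_ ?_ <;> simp [mulLin] <;> ring

lemma mulLin_smul_right (t : F) (l m : Fin 3 → F) : mulLin l (t • m) = t • mulLin l m := by
  refine ext6 ?_ ?_ ?_ ?_ ?_ ?_ <;> simp [mulLin] <;> ring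

lemma mulLin_comm (l m : Fin 3 → F) : mulLin l m = mulLin m l := by
  refine ext6 ?_ ?_ ?_ ?_ ?_ ?_ <;> simp [mulLin] <;> ring

lemma mulLin_sub_right (l m m' : Fin 3 → F) : mulLin l (m - m') = mulLin l m - mulLin l m' := by
  refine ext6 ?_ ?_ ?_ ?_ ?_ ?_ <;> simp [mulLin] <;> ring

lemma disc_mulLin (l m : Fin 3 → F) : disc (mulLin l m) = 0 := by
  simp [disc, mulLin]; ring

lemma disc_smul (t : F) (a : Fin 6 → F) : disc (t • a) = t ^ 3 * disc a := by
  simp [disc]; ring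

lemma vtx_disc (a : Fin 6 → F) (v : Fin 3 → F) (hv : v ≠ 0) (h : Vtx a v) : disc a = 0 := by
  obtain ⟨h1, h2, h3, h4⟩ := h
  rw [disc]
  rcases ne3 hv with hv | hv | hv <;> grind

lemma vtx_two (a : Fin 6 → F) (v w : Fin 3 → F) (hv : Vtx a v) (hw : Vtx a w)
    (hc : cr v w ≠ 0) : ∃ k : F, a = k • mulLin (cr v w) (cr v w) := by
  obtain ⟨p1, p2, p3, p4⟩ := hv
  obtain ⟨q1, q2, q3, q4⟩ := hw
  have e0 : cr v w 0 = v 1 * w 2 - v 2 * w 1 := rfl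
  have e1 : cr v w 1 = v 2 * w 0 - v 0 * w 2 := rfl
  have e2 : cr v w 2 = v 0 * w 1 - v 1 * w 0 := rfl
  have r00 : 2 * a 0 * cr v w 1 = a 1 * cr v w 0 := by
    rw [e0, e1]; linear_combination v 2 * q1 - w 2 * p1
  have r01 : 2 * a 3 * cr v w 0 = a 1 * cr v w 1 := by
    rw [e0, e1]; linear_combination w 2 * p2 - v 2 * q2
  have r02 : a 4 * cr v w 0 = a 2 * cr v w 1 := by
    rw [e0, e1]; linear_combination w 2 * p3 - v 2 * q3
  have r10 : 2 * a 0 * cr v w 2 = a 2 * cr v w 0 := by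
    rw [e0, e2]; linear_combination w 1 * p1 - v 1 * q1
  have r11 : a 1 * cr v w 2 = a 4 * cr v w 0 := by
    rw [e0, e2]; linear_combination w 1 * p2 - v 1 * q2
  have r12 : 2 * a 5 * cr v w 0 = a 2 * cr v w 2 := by
    rw [e0, e2]; linear_combination v 1 * q3 - w 1 * p3
  have r21 : 2 * a 3 * cr v w 2 = a 4 * cr v w 1 := by
    rw [e1, e2]; linear_combination v 0 * q2 - w 0 * p2
  have r22 : 2 * a 5 * cr v w 1 = a 4 * cr v w 2 := by
    rw [e1, e2]; linear_combination w 0 * p3 - v 0 * q3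
  have s0 : a 0 * cr v w 1 ^ 2 - a 1 * cr v w 0 * cr v w 1 + a 3 * cr v w 0 ^ 2 = 0 := by
    rw [e0, e1]; grind
  have s1 : a 0 * cr v w 2 ^ 2 - a 2 * cr v w 0 * cr v w 2 + a 5 * cr v w 0 ^ 2 = 0 := by
    rw [e0, e2]; grind
  have s2 : a 3 * cr v w 2 ^ 2 - a 4 * cr v w 1 * cr v w 2 + a 5 * cr v w 1 ^ 2 = 0 := by
    rw [e1, e2]; grind
  generalize cr v w = c at *
  clear p1 p2 p3 p4 q1 q2 q3 q4 e0 e1 e2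
  rcases ne3 hc with h | h | h
  · refine ⟨a 0 / c 0 ^ 2, ?_⟩
    refine ext6 ?_ ?_ ?_ ?_ ?_ ?_ <;> simp [mulLin] <;> field_simp <;> grind
  · refine ⟨a 3 / c 1 ^ 2, ?_⟩
    refine ext6 ?_ ?_ ?_ ?_ ?_ ?_ <;> simp [mulLin] <;> field_simp <;> grind
  · refine ⟨a 5 / c 2 ^ 2, ?_⟩
    refine ext6 ?_ ?_ ?_ ?_ ?_ ?_ <;> simp [mulLin] <;> field_simp <;> grind

lemma vtx_double (c : F) (hc : c ≠ 0) (l v : Fin 3 → F) :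
    Vtx (c • mulLin l l) v ↔ l 0 * v 0 + l 1 * v 1 + l 2 * v 2 = 0 := by
  constructor
  · rintro ⟨-, -, -, h⟩
    simp [mulLin] at h
    have : c * (l 0 * v 0 + l 1 * v 1 + l 2 * v 2) ^ 2 = 0 := by linear_combination h
    simpa [hc] using this
  · intro h
    refine ⟨?_, ?_, ?_, ?_⟩ <;> simp [mulLin]
    · linear_combination 2 * c * l 0 * h
    · linear_combination 2 * c * l 1 * h
    · linear_combination 2 * c * l 2 * h
    · linear_combination c * (l 0 * v 0 + l 1 * v 1 + l 2 * v 2) * h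

lemma Vtx.smul {a : Fin 6 → F} {v : Fin 3 → F} (h : Vtx a v) (t : F) : Vtx a (t • v) := by
  obtain ⟨h1, h2, h3, h4⟩ := h
  refine ⟨?_, ?_, ?_, ?_⟩ <;> simp
  · linear_combination t * h1
  · linear_combination t * h2
  · linear_combination t * h3
  · linear_combination t ^ 2 * h4

lemma two_zero_isSquare [Finite F] (h2 : (2 : F) = 0) (a : F) : ∃ b : F, a = b ^ 2 := by
  have hc : ringChar F = 2 := by
    have : CharP F 2 := CharTwo.of_one_ne_zero_of_two_eq_zero one_ne_zero h2
    exact ringChar.eq F 2 ▸ rfl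
  obtain ⟨b, hb⟩ := FiniteField.isSquare_of_char_two hc a
  exact ⟨b, by rw [hb]; ring⟩

lemma disc_vtx [Finite F] (a : Fin 6 → F) (h : disc a = 0) : ∃ v : Fin 3 → F, v ≠ 0 ∧ Vtx a v := by
  by_cases h2 : (2 : F) = 0
  · by_cases hz : a 4 = 0 ∧ a 2 = 0 ∧ a 1 = 0
    · obtain ⟨z4, z2, z1⟩ := hz
      obtain ⟨α, hα⟩ := two_zero_isSquare h2 (a 0)
      obtain ⟨β, hβ⟩ := two_zero_isSquare h2 (a 3)
      by_cases hab : α = 0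
      · refine ⟨![1, 0, 0], fun h => by simpa using congrFun h 0, ?_⟩
        refine ⟨?_, ?_, ?_, ?_⟩ <;> simp [hα, hab, z4, z2, z1]
      · refine ⟨![β, α, 0], fun h => hab (by simpa using congrFun h 1), ?_⟩
        refine ⟨?_, ?_, ?_, ?_⟩ <;> simp [hα, hβ, z4, z2, z1, h2]
        linear_combination α ^ 2 * β ^ 2 * h2
    · refine ⟨![a 4, a 2, a 1], fun h => hz ?_, ?_⟩
      · have e0 := congrFun h 0
        have e1 := congrFun h 1
        have e2 := congrFun h 2
        simp at e0 e1 e2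
        exact ⟨e0, e1, e2⟩
      · rw [disc] at h
        refine ⟨?_, ?_, ?_, ?_⟩ <;> simp
        · linear_combination (a 0 * a 4 + a 1 * a 2) * h2
        · linear_combination (a 3 * a 2 + a 1 * a 4) * h2
        · linear_combination (a 5 * a 1 + a 2 * a 4) * h2
        · linear_combination (-1) * h + (2 * a 0 * a 3 * a 5 + 2 * a 1 * a 2 * a 4) * h2
  · have hd : (!![2 * a 0, a 1, a 2; a 1, 2 * a 3, a 4; a 2, a 4, 2 * a 5]).det = 0 := by
      rw [Matrix.det_fin_three]
      simp only [Matrix.of_apply, Matrix.cons_val', Matrix.cons_val_zero, Matrix.cons_val_one,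
        Matrix.cons_val]
      rw [disc] at h
      linear_combination 2 * h
    obtain ⟨v, hv, hv0⟩ := Matrix.exists_mulVec_eq_zero_iff.mpr hd
    have e0 := congrFun hv0 0
    have e1 := congrFun hv0 1
    have e2 := congrFun hv0 2
    simp [Matrix.mulVec, dotProduct, Fin.sum_univ_three] at e0 e1 e2
    refine ⟨v, hv, e0, e1, e2, ?_⟩
    apply mul_left_cancel₀ h2
    linear_combination v 0 * e0 + v 1 * e1 + v 2 * e2

open scoped Classical in
lemma card_ker [Fintype F] {n : ℕ} (φ : (Fin (n + 1) → F) →ₗ[F] F) (h : φ ≠ 0) :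
    (Finset.univ.filter (fun v => φ v = 0)).card = Fintype.card F ^ n := by
  have h1 := LinearMap.finrank_range_add_finrank_ker φ
  have h2 : LinearMap.range φ = ⊤ := LinearMap.range_eq_top.mpr (LinearMap.surjective h)
  rw [h2, finrank_top] at h1
  simp at h1
  have h3 := Module.card_eq_pow_finrank (K := F) (V := LinearMap.ker φ)
  rw [show Module.finrank F (LinearMap.ker φ) = n by omega] at h3
  rw [← h3, ← Fintype.card_subtype]
  exact Fintype.card_congr (Equiv.refl _)

/-- Linear functional on `F^3` with coefficients `u`. -/
def lin3 (u : Fin 3 → F) : (Fin 3 → F) →ₗ[F] F where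
  toFun x := u 0 * x 0 + u 1 * x 1 + u 2 * x 2
  map_add' x z := by simp; ring
  map_smul' t x := by simp; ring

lemma lin3_ne (u : Fin 3 → F) (h : u ≠ 0) : lin3 u ≠ 0 := by
  intro hz
  have e0 := congrArg (fun f => f ![1, 0, 0]) hz
  have e1 := congrArg (fun f => f ![0, 1, 0]) hz
  have e2 := congrArg (fun f => f ![0, 0, 1]) hz
  simp [lin3] at e0 e1 e2
  exact h (ext3 e0 e1 e2)

/-- `bl y l` as a linear functional. -/
def blin (y : Fin 6 → F) (l : Fin 3 → F) : (Fin 3 → F) →ₗ[F] F where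
  toFun x := bl y l x
  map_add' x z := by simp [bl_eq]; ring
  map_smul' t x := by simp [bl_eq]; ring

/-- `Bform · y` as a linear functional. -/
def Blin (y : Fin 6 → F) : (Fin 6 → F) →ₗ[F] F where
  toFun a := Bform a y
  map_add' x z := by simp [Bform]; ring
  map_smul' t x := by simp [Bform]; ring

open scoped Classical in
lemma card_lin3 [Fintype F] (u : Fin 3 → F) (h : u ≠ 0) :
    (Finset.univ.filter (fun x : Fin 3 → F => u 0 * x 0 + u 1 * x 1 + u 2 * x 2 = 0)).card
      = Fintype.card F ^ 2 :=
  card_ker (lin3 u) (lin3_ne u h)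

open scoped Classical in
lemma card_bl [Fintype F] (y : Fin 6 → F) (hy : dt y ≠ 0) (l : Fin 3 → F) (h : l ≠ 0) :
    (Finset.univ.filter (fun x : Fin 3 → F => bl y l x = 0)).card = Fintype.card F ^ 2 :=
  card_ker (blin y l) (fun hz => h (bl_nondeg y hy l (fun m => LinearMap.congr_fun hz m)))

open scoped Classical in
lemma card_squab [Fintype F] (y : Fin 6 → F) (hy : dt y ≠ 0) :
    (Finset.univ.filter (fun a : Fin 6 → F => a ∈ squab y)).card = Fintype.card F ^ 5 := by
  refine card_ker (Blin y) (fun hz => ?_)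
  have : (![1, 0, 0] : Fin 3 → F) = 0 :=
    bl_nondeg y hy _ (fun m => LinearMap.congr_fun hz (mulLin _ m))
  simpa using congrFun this 0

open scoped Classical in
lemma card_erase_zero {V : Type} [Fintype V] [Zero V] (p : V → Prop) (h0 : p 0) (n : ℕ)
    (h : (Finset.univ.filter p).card = n) :
    (Finset.univ.filter (fun v => v ≠ 0 ∧ p v)).card = n - 1 := by
  rw [← h, ← Finset.card_erase_of_mem (a := (0 : V)) (by simpa using h0)]
  congr 1
  ext v
  simp

open scoped Classical in
lemma card_multiples [Fintype F] {n : ℕ} (v : Fin n → F) (hv : v ≠ 0) :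
    (Finset.univ.filter (fun w : Fin n → F => w ≠ 0 ∧ ∃ t : F, w = t • v)).card
      = Fintype.card F - 1 := by
  suffices key : (Finset.univ.filter (fun w : Fin n → F => ∃ t : F, w = t • v)).card
      = Fintype.card F by
    convert card_erase_zero (fun w : Fin n → F => ∃ t : F, w = t • v) ⟨0, by simp⟩ _ ?_
    convert key
  rw [← Finset.card_univ,
    ← Finset.card_image_of_injective (f := fun t : F => t • v) _ (smul_left_injective F hv)]
  congr 1
  ext w
  simp [eq_comm]

open scoped Classical in
lemma numConics_mul [Fintype F] (W : Submodule F (Fin 6 → F)) (T : (Fin 6 → F) → Prop)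
    (hT : ∀ (t : F) a, t ≠ 0 → T a → T (t • a)) :
    numConics W T * (Fintype.card F - 1) =
      (Finset.univ.filter (fun a => (a ≠ 0 ∧ a ∈ W) ∧ T a)).card := by
  set s := Finset.univ.filter (fun a : Fin 6 → F => (a ≠ 0 ∧ a ∈ W) ∧ T a) with hs
  have h1 : numConics W T =
      (s.image (fun a => Submodule.span F {a})).card := by
    rw [numConics, ← Set.ncard_coe_finset]
    congr 1
    ext P
    simp [hs, eq_comm, and_assoc]
  rw [h1, Finset.card_eq_sum_card_image (fun a => Submodule.span F {a}) s]
  rw [Finset.sum_const_nat (m := Fintype.card F - 1)]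
  intro P hP
  obtain ⟨a, ha, rfl⟩ := Finset.mem_image.mp hP
  simp only [hs, Finset.mem_filter, Finset.mem_univ, true_and] at ha
  rw [← card_multiples a ha.1.1]
  congr 1
  ext w
  simp only [hs, Finset.mem_filter, Finset.mem_univ, true_and]
  constructor
  · rintro ⟨⟨⟨hw, hW⟩, hTw⟩, hsp⟩
    refine ⟨hw, ?_⟩
    have : w ∈ Submodule.span F {a} := hsp ▸ Submodule.mem_span_singleton_self w
    obtain ⟨t, ht⟩ := Submodule.mem_span_singleton.mp this
    exact ⟨t, ht.symm⟩
  · rintro ⟨hw, t, rfl⟩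
    have ht : t ≠ 0 := by rintro rfl; simp at hw
    refine ⟨⟨⟨hw, W.smul_mem t ha.1.2⟩, hT t a ht ha.2⟩, ?_⟩
    exact Submodule.span_singleton_smul_eq (IsUnit.mk0 t ht) a

/-- Parametrization of the forms with a given vertex. -/
def par (l m : Fin 3 → F) (x : Fin 3 → F) : Fin 6 → F :=
  x 0 • mulLin l l + x 1 • mulLin l m + x 2 • mulLin m m

open scoped Classical in
lemma card_vtx_aux [Fintype F] (y : Fin 6 → F) (hy : dt y ≠ 0) (v l m : Fin 3 → F)
    (hc : cr l m ≠ 0) (hinj : Function.Injective (par l m))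
    (hV : ∀ a, Vtx a v ↔ ∃ x, par l m x = a) :
    (Finset.univ.filter (fun a : Fin 6 → F => a ∈ squab y ∧ Vtx a v)).card
      = Fintype.card F ^ 2 := by
  have hu : (![bl y l l, bl y l m, bl y m m] : Fin 3 → F) ≠ 0 := by
    intro h
    have e0 := congrFun h 0
    have e1 := congrFun h 1
    have e2 := congrFun h 2
    simp at e0 e1 e2
    exact hc (iso_dep y hy l m e0 e1 e2)
  rw [← card_lin3 _ hu, ← Finset.card_image_of_injective _ hinj]
  congr 1
  have key : ∀ x, par l m x ∈ squab y ↔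
      bl y l l * x 0 + bl y l m * x 1 + bl y m m * x 2 = 0 := by
    intro x
    change Bform _ y = 0 ↔ _
    have : Bform (par l m x) y = bl y l l * x 0 + bl y l m * x 1 + bl y m m * x 2 := by
      simp [Bform, bl, par]; ring
    rw [this]
  ext a
  simp only [Finset.mem_filter, Finset.mem_univ, true_and, Finset.mem_image, hV]
  constructor
  · rintro ⟨h, x, rfl⟩
    exact ⟨x, by simpa using (key x).mp h, rfl⟩
  · rintro ⟨x, h, rfl⟩
    exact ⟨(key x).mpr (by simpa using h), x, rfl⟩

open scoped Classical in
lemma card_vtx [Fintype F] (y : Fin 6 → F) (hy : dt y ≠ 0) (v : Fin 3 → F) (hv : v ≠ 0) :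
    (Finset.univ.filter (fun a : Fin 6 → F => a ∈ squab y ∧ Vtx a v)).card
      = Fintype.card F ^ 2 := by
  rcases ne3 hv with h | h | h
  · apply card_vtx_aux y hy v ![-v 1, v 0, 0] ![-v 2, 0, v 0]
    · intro hc
      have := congrFun hc 0
      simp [cr, h] at this
    · intro x z hxz
      have e3 := congrFun hxz 3
      have e4 := congrFun hxz 4
      have e5 := congrFun hxz 5
      simp [par, mulLin, h] at e3 e4 e5
      exact ext3 e3 e4 e5
    · intro a
      constructor
      · rintro ⟨h1, h2, h3, h4⟩
        refine ⟨![a 3 / v 0 ^ 2, a 4 / v 0 ^ 2, a 5 / v 0 ^ 2], ?_⟩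
        refine ext6 ?_ ?_ ?_ ?_ ?_ ?_ <;> simp [par, mulLin] <;> field_simp <;> grind
      · rintro ⟨x, rfl⟩
        refine ⟨?_, ?_, ?_, ?_⟩ <;> simp [par, mulLin] <;> ring
  · apply card_vtx_aux y hy v ![v 1, -v 0, 0] ![0, -v 2, v 1]
    · intro hc
      have := congrFun hc 1
      simp [cr, h] at this
    · intro x z hxz
      have e3 := congrFun hxz 0
      have e4 := congrFun hxz 2
      have e5 := congrFun hxz 5
      simp [par, mulLin, h] at e3 e4 e5
      exact ext3 e3 e4 e5
    · intro a
      constructor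
      · rintro ⟨h1, h2, h3, h4⟩
        refine ⟨![a 0 / v 1 ^ 2, a 2 / v 1 ^ 2, a 5 / v 1 ^ 2], ?_⟩
        refine ext6 ?_ ?_ ?_ ?_ ?_ ?_ <;> simp [par, mulLin] <;> field_simp <;> grind
      · rintro ⟨x, rfl⟩
        refine ⟨?_, ?_, ?_, ?_⟩ <;> simp [par, mulLin] <;> ring
  · apply card_vtx_aux y hy v ![v 2, 0, -v 0] ![0, v 2, -v 1]
    · intro hc
      have := congrFun hc 2
      simp [cr, h] at this
    · intro x z hxz
      have e3 := congrFun hxz 0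
      have e4 := congrFun hxz 1
      have e5 := congrFun hxz 3
      simp [par, mulLin, h] at e3 e4 e5
      exact ext3 e3 e4 e5
    · intro a
      constructor
      · rintro ⟨h1, h2, h3, h4⟩
        refine ⟨![a 0 / v 2 ^ 2, a 1 / v 2 ^ 2, a 3 / v 2 ^ 2], ?_⟩
        refine ext6 ?_ ?_ ?_ ?_ ?_ ?_ <;> simp [par, mulLin] <;> field_simp <;> grind
      · rintro ⟨x, rfl⟩
        refine ⟨?_, ?_, ?_, ?_⟩ <;> simp [par, mulLin] <;> ring

lemma exists_iso [Fintype F] (y : Fin 6 → F) : ∃ e : Fin 3 → F, e ≠ 0 ∧ bl y e e = 0 := by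
  classical
  obtain ⟨p, hp⟩ := CharP.exists F
  let c : Fin 3 → Fin 3 → F := fun i j => M y i j
  let f : MvPolynomial (Fin 3) F :=
    ∑ i, ∑ j, MvPolynomial.C (c i j) * MvPolynomial.X i * MvPolynomial.X j
  have hev : ∀ x, MvPolynomial.eval x f = bl y x x := by
    intro x
    simp [f, c, bl_eq, M, Fin.sum_univ_three]
    ring
  have hdeg : f.totalDegree < Fintype.card (Fin 3) := by
    have : f.totalDegree ≤ 2 := by
      refine MvPolynomial.totalDegree_finsetSum_le fun i _ => ?_
      refine MvPolynomial.totalDegree_finsetSum_le fun j _ => ?_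
      refine (MvPolynomial.totalDegree_mul _ _).trans ?_
      have h1 := MvPolynomial.totalDegree_mul (MvPolynomial.C (c i j)) (MvPolynomial.X (R := F) i)
      have h2 := MvPolynomial.totalDegree_X (R := F) i
      have h3 := MvPolynomial.totalDegree_X (R := F) j
      have h4 := MvPolynomial.totalDegree_C (σ := Fin 3) (c i j)
      omega
    simp
    omega
  have hdvd := char_dvd_card_solutions p hdeg
  have hpp : p ≠ 1 := CharP.char_ne_one F p
  by_contra! hno
  have : Fintype.card {x : Fin 3 → F // MvPolynomial.eval x f = 0} = 1 := by
    rw [Fintype.card_eq_one_iff]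
    refine ⟨⟨0, by rw [hev]; simp [bl_eq]⟩, ?_⟩
    rintro ⟨x, hx⟩
    rw [hev] at hx
    by_contra hne
    exact hno x (fun h => hne (Subtype.ext h)) hx
  rw [this] at hdvd
  exact hpp (Nat.dvd_one.mp hdvd)

lemma bl_add_smul (y : Fin 6 → F) (w e : Fin 3 → F) (t : F) :
    bl y (w + t • e) (w + t • e) = bl y w w + 2 * t * bl y e w + t ^ 2 * bl y e e := by
  simp [bl_eq]; ring

open scoped Classical in
lemma card_iso [Fintype F] (y : Fin 6 → F) (hy : dt y ≠ 0) :
    (Finset.univ.filter (fun l : Fin 3 → F => bl y l l = 0)).card = Fintype.card F ^ 2 := by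
  by_cases h2 : (2 : F) = 0
  · obtain ⟨α, hα⟩ := two_zero_isSquare h2 (y 0)
    obtain ⟨β, hβ⟩ := two_zero_isSquare h2 (y 3)
    obtain ⟨γ, hγ⟩ := two_zero_isSquare h2 (y 5)
    have hu : (![α, β, γ] : Fin 3 → F) ≠ 0 := by
      intro h
      have e0 := congrFun h 0
      have e1 := congrFun h 1
      have e2 := congrFun h 2
      simp at e0 e1 e2
      apply hy
      rw [dt, hα, hβ, hγ, e0, e1, e2]
      linear_combination (y 1 * y 2 * y 4) * h2
    rw [← card_lin3 _ hu]
    congr 1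
    ext l
    simp only [Finset.mem_filter, Finset.mem_univ, true_and]
    have : bl y l l = (α * l 0 + β * l 1 + γ * l 2) ^ 2 := by
      rw [bl_eq, hα, hβ, hγ]
      linear_combination (l 0 * l 1 * y 1 + l 0 * l 2 * y 2 + l 1 * l 2 * y 4 - α * β * l 0 * l 1
        - α * γ * l 0 * l 2 - β * γ * l 1 * l 2) * h2
    rw [this]
    simp
  · obtain ⟨e, he, hee⟩ := exists_iso y
    set q := Fintype.card F with hq
    have hq1 : 1 < q := Fintype.one_lt_card
    have hdc := Finset.sum_card_bipartiteAbove_eq_sum_card_bipartiteBelow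
      (s := (Finset.univ : Finset F)) (t := (Finset.univ : Finset (Fin 3 → F)))
      (fun t w => bl y (w + t • e) (w + t • e) = 0)
    have hL : ∀ t : F, (Finset.bipartiteAbove (fun (t : F) (w : Fin 3 → F) =>
        bl y (w + t • e) (w + t • e) = 0) Finset.univ t).card =
        (Finset.univ.filter (fun l : Fin 3 → F => bl y l l = 0)).card := by
      intro t
      refine Finset.card_bij (fun w _ => w + t • e) ?_ ?_ ?_
      · intro w hw
        simpa [Finset.bipartiteAbove] using hw
      · intro w _ w' _ h
        exact add_right_cancel h
      · intro w hw
        refine ⟨w - t • e, ?_, by simp⟩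
        simpa [Finset.bipartiteAbove] using hw
    have hR : ∀ w : Fin 3 → F, (Finset.bipartiteBelow (fun (t : F) (w : Fin 3 → F) =>
        bl y (w + t • e) (w + t • e) = 0) Finset.univ w).card =
        (if bl y e w ≠ 0 then 1 else 0) + (if (∃ t : F, w = t • e) then q else 0) := by
      intro w
      simp only [Finset.bipartiteBelow, bl_add_smul, hee]
      by_cases hb : bl y e w = 0
      · by_cases hm : ∃ t : F, w = t • e
        · obtain ⟨t, rfl⟩ := hm
          have : bl y (t • e) (t • e) = 0 := by
            have : bl y (t • e) (t • e) = t ^ 2 * bl y e e := by simp [bl_eq]; ring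
            rw [this, hee, mul_zero]
          rw [if_neg (by simpa using hb), if_pos ⟨t, rfl⟩]
          simp [hb, this, hq]
        · have : bl y w w ≠ 0 := fun h => hm ((cr_eq_zero_iff e w he).mp (iso_dep y hy e w hee hb h))
          rw [if_neg (by simpa using hb), if_neg hm]
          simp [hb, this]
      · have hm : ¬ ∃ t : F, w = t • e := by
          rintro ⟨t, rfl⟩
          apply hb
          have : bl y e (t • e) = t * bl y e e := by simp [bl_eq]; ring
          rw [this, hee, mul_zero]
        rw [if_pos hb, if_neg hm, add_zero, Finset.card_eq_one]
        refine ⟨- bl y w w / (2 * bl y e w), ?_⟩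
        ext t
        simp only [Finset.mem_filter, Finset.mem_univ, true_and, Finset.mem_singleton]
        rw [eq_div_iff (mul_ne_zero h2 hb)]
        constructor <;> intro h <;> linear_combination h
    rw [Finset.sum_congr rfl (fun t _ => hL t), Finset.sum_congr rfl (fun w _ => hR w),
      Finset.sum_add_distrib, ← Finset.sum_filter, ← Finset.sum_filter, Finset.sum_const,
      Finset.sum_const, Finset.sum_const, Finset.card_univ, ← hq] at hdc
    have c1 : (Finset.univ.filter (fun w : Fin 3 → F => ∃ t : F, w = t • e)).card = q := by
      rw [hq, ← Finset.card_univ,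
        ← Finset.card_image_of_injective (f := fun t : F => t • e) _ (smul_left_injective F he)]
      congr 1
      ext w
      simp [eq_comm]
    have c2 := Finset.card_filter_add_card_filter_not (s := (Finset.univ : Finset (Fin 3 → F)))
      (fun w => bl y e w = 0)
    rw [card_bl y hy e he, Finset.card_univ, Fintype.card_fun, Fintype.card_fin, ← hq] at c2
    rw [c1] at hdc
    simp only [smul_eq_mul, mul_one] at hdc
    have : q * (Finset.univ.filter (fun l : Fin 3 → F => bl y l l = 0)).card = q * q ^ 2 := by
      rw [hdc]
      simp only [ne_eq]
      nlinarith [c2]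
    exact Nat.eq_of_mul_eq_mul_left (by omega) this

open scoped Classical in
/-- Nonzero vectors of the squab. -/
noncomputable def SS [Fintype F] (y : Fin 6 → F) : Finset (Fin 6 → F) :=
  Finset.univ.filter (fun a => a ≠ 0 ∧ a ∈ squab y)

lemma real_not_double (a : Fin 6 → F) (hr : IsRealPair a) : ¬ IsDoubleLine a := by
  rintro ⟨c, l, hc, hl, h⟩
  obtain ⟨l1, l2, h1, h2, rfl⟩ := hr
  have hl1 : l1 ≠ 0 := fun h => h2 ⟨0, by simp [h]⟩
  have hl2 : l2 ≠ 0 := fun h => h1 ⟨0, by simp [h]⟩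
  rw [← mulLin_smul_right] at h
  have a1 : cr l1 l = 0 := by
    rcases mulLin_factor _ _ _ _ h.symm with h | h
    · exact h
    · rw [cr_eq_zero_iff _ _ hl1] at h ⊢
      obtain ⟨t, ht⟩ := h
      exact ⟨c⁻¹ * t, by rw [mul_smul, ← ht, smul_smul, inv_mul_cancel₀ hc, one_smul]⟩
  have a2 : cr l2 l = 0 := by
    rw [mulLin_comm] at h
    rcases mulLin_factor _ _ _ _ h.symm with h | h
    · exact h
    · rw [cr_eq_zero_iff _ _ hl2] at h ⊢
      obtain ⟨t, ht⟩ := h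
      exact ⟨c⁻¹ * t, by rw [mul_smul, ← ht, smul_smul, inv_mul_cancel₀ hc, one_smul]⟩
  obtain ⟨t, ht⟩ := (cr_eq_zero_iff _ _ hl1).mp a1
  obtain ⟨s, hs⟩ := (cr_eq_zero_iff _ _ hl2).mp a2
  have hs0 : s ≠ 0 := by rintro rfl; exact hl (by simpa using hs)
  exact h1 ⟨s⁻¹ * t, by rw [mul_smul, ← ht, hs, smul_smul, inv_mul_cancel₀ hs0, one_smul]⟩

lemma prod_cases (l m : Fin 3 → F) (h : mulLin l m ≠ 0) :
    IsDoubleLine (mulLin l m) ∨ IsRealPair (mulLin l m) := by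
  have hl : l ≠ 0 := by rintro rfl; exact h (by ext i; fin_cases i <;> simp [mulLin])
  have hm : m ≠ 0 := by rintro rfl; exact h (by ext i; fin_cases i <;> simp [mulLin])
  by_cases h1 : ∃ t : F, m = t • l
  · left
    obtain ⟨t, rfl⟩ := h1
    refine ⟨t, l, ?_, hl, mulLin_smul_right _ _ _⟩
    rintro rfl
    simp at hm
  · right
    refine ⟨l, m, h1, ?_, rfl⟩
    rintro ⟨t, rfl⟩
    have ht : t ≠ 0 := by rintro rfl; simp at hl
    exact h1 ⟨t⁻¹, by rw [smul_smul, inv_mul_cancel₀ ht, one_smul]⟩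

lemma smul_mem_of_dep {t : F} {l w : Fin 3 → F} (_hw : w ≠ 0) (h : l = t • w) (hl : l ≠ 0) :
    ∃ s : F, w = s • l := by
  have ht : t ≠ 0 := by rintro rfl; simp at h; exact hl h
  exact ⟨t⁻¹, by rw [h, smul_smul, inv_mul_cancel₀ ht, one_smul]⟩

/-- Divisors of a double line. -/
lemma dvd_double (c : F) (hc : c ≠ 0) (l w : Fin 3 → F) (hl : l ≠ 0) (hw : w ≠ 0) :
    (∃ m, c • mulLin l l = mulLin w m) ↔ ∃ t : F, w = t • l := by
  constructor
  · rintro ⟨m, h⟩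
    rw [← mulLin_smul_right] at h
    have hcl : c • l ≠ 0 := smul_ne_zero hc hl
    rcases mulLin_factor _ _ _ _ h with h | h
    · obtain ⟨t, ht⟩ := (cr_eq_zero_iff _ _ hw).mp h
      exact smul_mem_of_dep hw ht hl
    · obtain ⟨t, ht⟩ := (cr_eq_zero_iff _ _ hw).mp h
      obtain ⟨s, hs⟩ := smul_mem_of_dep hw ht hcl
      exact ⟨s * c, by rw [mul_smul]; exact hs⟩
  · rintro ⟨t, rfl⟩
    have ht : t ≠ 0 := by rintro rfl; simp at hw
    refine ⟨(t⁻¹ * c) • l, ?_⟩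
    rw [mulLin_smul_left, mulLin_smul_right, smul_smul, ← mul_assoc, mul_inv_cancel₀ ht, one_mul]

/-- Divisors of a real pair. -/
lemma dvd_real (l1 l2 w : Fin 3 → F) (h1 : l1 ≠ 0) (h2 : l2 ≠ 0) (hw : w ≠ 0) :
    (∃ m, mulLin l1 l2 = mulLin w m) ↔ (∃ t : F, w = t • l1) ∨ (∃ t : F, w = t • l2) := by
  constructor
  · rintro ⟨m, h⟩
    rcases mulLin_factor _ _ _ _ h with h | h
    · obtain ⟨t, ht⟩ := (cr_eq_zero_iff _ _ hw).mp h
      exact Or.inl (smul_mem_of_dep hw ht h1)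
    · obtain ⟨t, ht⟩ := (cr_eq_zero_iff _ _ hw).mp h
      exact Or.inr (smul_mem_of_dep hw ht h2)
  · rintro (⟨t, rfl⟩ | ⟨t, rfl⟩)
    · have ht : t ≠ 0 := by rintro rfl; simp at hw
      refine ⟨t⁻¹ • l2, ?_⟩
      rw [mulLin_smul_left, mulLin_smul_right, smul_smul, mul_inv_cancel₀ ht, one_smul]
    · have ht : t ≠ 0 := by rintro rfl; simp at hw
      refine ⟨t⁻¹ • l1, ?_⟩
      rw [mulLin_smul_left, mulLin_smul_right, smul_smul, mul_inv_cancel₀ ht, one_smul, mulLin_comm]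

lemma mulLin_ne {l m : Fin 3 → F} (hl : l ≠ 0) (hm : m ≠ 0) : mulLin l m ≠ 0 := by
  intro h
  rcases mulLin_eq_zero l m h with h | h
  · exact hl h
  · exact hm h

lemma smul_mem_squab {y : Fin 6 → F} {c : F} (hc : c ≠ 0) {l m : Fin 3 → F} :
    c • mulLin l m ∈ squab y ↔ bl y l m = 0 := by
  rw [Submodule.smul_mem_iff _ hc]
  exact Iff.rfl

open scoped Classical in
lemma count_double [Fintype F] (y : Fin 6 → F) (hy : dt y ≠ 0) :
    ((SS y).filter IsDoubleLine).card = Fintype.card F ^ 2 - 1 := by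
  have hq1 : 1 < Fintype.card F := Fintype.one_lt_card
  have hs : (Finset.univ.filter (fun l : Fin 3 → F => l ≠ 0 ∧ bl y l l = 0)).card =
      Fintype.card F ^ 2 - 1 := by
    convert card_erase_zero (fun l : Fin 3 → F => bl y l l = 0) (by simp [bl_eq]) _
      (by convert card_iso y hy)
  have key := Finset.card_mul_eq_card_mul
    (s := Finset.univ.filter (fun l : Fin 3 → F => l ≠ 0 ∧ bl y l l = 0))
    (t := (SS y).filter IsDoubleLine)
    (m := Fintype.card F - 1) (n := Fintype.card F - 1)
    (fun l a => ∃ c : F, c ≠ 0 ∧ a = c • mulLin l l) ?_ ?_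
  · rw [hs] at key
    exact (Nat.eq_of_mul_eq_mul_right (by omega) key).symm
  · intro l hl
    simp only [Finset.mem_filter, Finset.mem_univ, true_and] at hl
    rw [← card_multiples (mulLin l l) (mulLin_ne hl.1 hl.1)]
    congr 1
    ext a
    simp only [Finset.bipartiteAbove, SS, Finset.mem_filter, Finset.mem_univ, true_and]
    constructor
    · rintro ⟨⟨⟨h1, h2⟩, h3⟩, c, hc, h⟩
      exact ⟨h1, c, h⟩
    · rintro ⟨h1, c, rfl⟩
      have hc : c ≠ 0 := by rintro rfl; simp at h1
      exact ⟨⟨⟨h1, (smul_mem_squab hc).mpr hl.2⟩, c, l, hc, hl.1, rfl⟩, c, hc, rfl⟩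
  · intro a ha
    simp only [SS, Finset.mem_filter, Finset.mem_univ, true_and] at ha
    obtain ⟨⟨ha0, has⟩, c, l, hc, hl, rfl⟩ := ha
    rw [smul_mem_squab hc] at has
    rw [← card_multiples l hl]
    congr 1
    ext w
    simp only [Finset.bipartiteBelow, Finset.mem_filter, Finset.mem_univ, true_and]
    constructor
    · rintro ⟨⟨hw, hb⟩, d, hd, h⟩
      refine ⟨hw, (dvd_double c hc l w hl hw).mp ⟨d • w, ?_⟩⟩
      rw [h, mulLin_smul_right]
    · rintro ⟨hw, t, rfl⟩
      have ht : t ≠ 0 := by rintro rfl; simp at hw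
      refine ⟨⟨hw, ?_⟩, c * t⁻¹ * t⁻¹, by simp [hc, ht], ?_⟩
      · have : bl y (t • l) (t • l) = t ^ 2 * bl y l l := by simp [bl_eq]; ring
        rw [this, has, mul_zero]
      · rw [mulLin_smul_left, mulLin_smul_right, smul_smul, smul_smul]
        congr 1
        field_simp

open scoped Classical in
lemma card_nonzero3 [Fintype F] :
    (Finset.univ.filter (fun l : Fin 3 → F => l ≠ 0)).card = Fintype.card F ^ 3 - 1 := by
  have := card_erase_zero (fun _ : Fin 3 → F => True) trivial (Fintype.card F ^ 3) (by simp)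
  simpa using this

open scoped Classical in
lemma count_dvd [Fintype F] (y : Fin 6 → F) (hy : dt y ≠ 0) :
    (Fintype.card F ^ 3 - 1) * (Fintype.card F ^ 2 - 1) =
    ((SS y).filter IsDoubleLine).card * (Fintype.card F - 1) +
    ((SS y).filter IsRealPair).card * (2 * (Fintype.card F - 1)) := by
  have hdc := Finset.sum_card_bipartiteAbove_eq_sum_card_bipartiteBelow
    (s := Finset.univ.filter (fun l : Fin 3 → F => l ≠ 0)) (t := SS y)
    (fun l a => ∃ m, a = mulLin l m)
  rw [Finset.sum_const_nat (m := Fintype.card F ^ 2 - 1), card_nonzero3] at hdc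
  · rw [hdc, Finset.sum_congr rfl (g := fun a => (if IsDoubleLine a then Fintype.card F - 1 else 0) +
      (if IsRealPair a then 2 * (Fintype.card F - 1) else 0)), Finset.sum_add_distrib,
      ← Finset.sum_filter, ← Finset.sum_filter, Finset.sum_const, Finset.sum_const]
    · simp
    intro a ha
    simp only [SS, Finset.mem_filter, Finset.mem_univ, true_and] at ha
    by_cases hD : IsDoubleLine a
    · have hR : ¬ IsRealPair a := fun h => real_not_double a h hD
      rw [if_pos hD, if_neg hR, add_zero]
      obtain ⟨c, l, hc, hl, rfl⟩ := hD
      rw [← card_multiples l hl]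
      congr 1
      ext w
      simp only [Finset.bipartiteBelow, Finset.mem_filter, Finset.mem_univ, true_and]
      exact and_congr_right (fun hw => dvd_double c hc l w hl hw)
    · by_cases hR : IsRealPair a
      · rw [if_neg hD, if_pos hR, zero_add]
        obtain ⟨l1, l2, h1, h2, rfl⟩ := hR
        have hl1 : l1 ≠ 0 := fun h => h2 ⟨0, by simp [h]⟩
        have hl2 : l2 ≠ 0 := fun h => h1 ⟨0, by simp [h]⟩
        rw [two_mul]
        nth_rewrite 1 [← card_multiples l1 hl1]
        rw [← card_multiples l2 hl2, ← Finset.card_union_of_disjoint]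
        · congr 1
          ext w
          simp only [Finset.bipartiteBelow, Finset.mem_filter, Finset.mem_univ, true_and,
            Finset.mem_union, ← and_or_left]
          exact and_congr_right (fun hw => dvd_real l1 l2 w hl1 hl2 hw)
        · rw [Finset.disjoint_left]
          intro w hw hw'
          simp only [Finset.mem_filter, Finset.mem_univ, true_and] at hw hw'
          obtain ⟨hw, t, ht⟩ := hw
          obtain ⟨-, s, hs⟩ := hw'
          obtain ⟨r, hr⟩ := smul_mem_of_dep hl1 ht hw
          exact h2 ⟨r * s, by rw [mul_smul, ← hs, ← hr]⟩
      · rw [if_neg hD, if_neg hR, add_zero, Finset.card_eq_zero]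
        ext w
        simp only [Finset.bipartiteBelow, Finset.mem_filter, Finset.mem_univ, true_and,
          Finset.notMem_empty, iff_false]
        rintro ⟨hw, m, rfl⟩
        rcases prod_cases _ _ ha.1 with h | h
        · exact hD h
        · exact hR h
  · intro l hl
    simp only [Finset.mem_filter, Finset.mem_univ, true_and] at hl
    have hs := card_erase_zero (fun m : Fin 3 → F => bl y l m = 0) (by simp [bl_eq]) _
      (card_bl y hy l hl)
    rw [← hs]
    symm
    refine Finset.card_bij (fun m _ => mulLin l m) ?_ ?_ ?_
    · intro m hm
      simp only [Finset.mem_filter, Finset.mem_univ, true_and] at hm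
      simp only [Finset.bipartiteAbove, SS, Finset.mem_filter, Finset.mem_univ, true_and]
      exact ⟨⟨mulLin_ne hl hm.1, hm.2⟩, m, rfl⟩
    · intro m _ m' _ h
      have : mulLin l (m - m') = 0 := by rw [mulLin_sub_right, h, sub_self]
      rcases mulLin_eq_zero _ _ this with h | h
      · exact absurd h hl
      · exact sub_eq_zero.mp h
    · intro a ha
      simp only [Finset.bipartiteAbove, SS, Finset.mem_filter, Finset.mem_univ, true_and] at ha
      obtain ⟨⟨h0, hs⟩, m, rfl⟩ := ha
      refine ⟨m, ?_, rfl⟩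
      simp only [Finset.mem_filter, Finset.mem_univ, true_and]
      refine ⟨?_, hs⟩
      rintro rfl
      exact h0 (by ext i; fin_cases i <;> simp [mulLin])

open scoped Classical in
lemma count_vtx [Fintype F] (y : Fin 6 → F) (hy : dt y ≠ 0) :
    (Fintype.card F ^ 3 - 1) * (Fintype.card F ^ 2 - 1) =
    ((SS y).filter IsDoubleLine).card * (Fintype.card F ^ 2 - 1) +
    ((SS y).filter (fun a => ¬ IsDoubleLine a ∧ disc a = 0)).card * (Fintype.card F - 1) := by
  have hdc := Finset.sum_card_bipartiteAbove_eq_sum_card_bipartiteBelow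
    (s := Finset.univ.filter (fun l : Fin 3 → F => l ≠ 0)) (t := SS y)
    (fun v a => Vtx a v)
  rw [Finset.sum_const_nat (m := Fintype.card F ^ 2 - 1), card_nonzero3] at hdc
  · rw [hdc, Finset.sum_congr rfl (g := fun a =>
      (if IsDoubleLine a then Fintype.card F ^ 2 - 1 else 0) +
      (if ¬ IsDoubleLine a ∧ disc a = 0 then Fintype.card F - 1 else 0)), Finset.sum_add_distrib,
      ← Finset.sum_filter, ← Finset.sum_filter, Finset.sum_const, Finset.sum_const]
    · simp
    intro a ha
    simp only [SS, Finset.mem_filter, Finset.mem_univ, true_and] at ha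
    by_cases hD : IsDoubleLine a
    · rw [if_pos hD, if_neg (fun h => h.1 hD), add_zero]
      obtain ⟨c, l, hc, hl, rfl⟩ := hD
      rw [← card_erase_zero (fun x : Fin 3 → F => l 0 * x 0 + l 1 * x 1 + l 2 * x 2 = 0) (by simp)
        _ (card_lin3 l hl)]
      congr 1
      ext w
      simp only [Finset.bipartiteBelow, Finset.mem_filter, Finset.mem_univ, true_and]
      exact and_congr_right (fun hw => vtx_double c hc l w)
    · by_cases hR : disc a = 0
      · rw [if_neg hD, if_pos ⟨hD, hR⟩, zero_add]
        obtain ⟨v, hv, hV⟩ := disc_vtx a hR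
        rw [← card_multiples v hv]
        congr 1
        ext w
        simp only [Finset.bipartiteBelow, Finset.mem_filter, Finset.mem_univ, true_and]
        refine and_congr_right (fun hw => ⟨fun h => ?_, ?_⟩)
        · rw [← cr_eq_zero_iff v w hv]
          by_contra hc
          obtain ⟨k, hk⟩ := vtx_two a v w hV h hc
          refine hD ⟨k, _, ?_, hc, hk⟩
          rintro rfl
          exact ha.1 (by simpa using hk)
        · rintro ⟨t, rfl⟩
          exact hV.smul t
      · rw [if_neg hD, if_neg (fun h => hR h.2), add_zero, Finset.card_eq_zero]
        ext w
        simp only [Finset.bipartiteBelow, Finset.mem_filter, Finset.mem_univ, true_and,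
          Finset.notMem_empty, iff_false]
        rintro ⟨hw, h⟩
        exact hR (vtx_disc a w hw h)
  · intro v hv
    simp only [Finset.mem_filter, Finset.mem_univ, true_and] at hv
    rw [← card_erase_zero (fun a : Fin 6 → F => a ∈ squab y ∧ Vtx a v)
      ⟨(squab y).zero_mem, by simp [Vtx]⟩ (Fintype.card F ^ 2)
      (by convert card_vtx y hy v hv)]
    congr 1
    ext a
    simp only [Finset.bipartiteAbove, SS, Finset.mem_filter, Finset.mem_univ, true_and, and_assoc]

open scoped Classical in
lemma count_total [Fintype F] (y : Fin 6 → F) (hy : dt y ≠ 0) :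
    (SS y).card = Fintype.card F ^ 5 - 1 := by
  rw [SS]
  convert card_erase_zero (fun a : Fin 6 → F => a ∈ squab y) (squab y).zero_mem
    (Fintype.card F ^ 5) (by convert card_squab y hy)

lemma double_disc (a : Fin 6 → F) (h : IsDoubleLine a) : disc a = 0 := by
  obtain ⟨c, l, -, -, rfl⟩ := h
  rw [disc_smul, disc_mulLin, mul_zero]

lemma double_prod (a : Fin 6 → F) (h : IsDoubleLine a) : ∃ l1 l2 : Fin 3 → F, a = mulLin l1 l2 := by
  obtain ⟨c, l, -, -, rfl⟩ := h
  exact ⟨l, c • l, by rw [mulLin_smul_right]⟩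

open scoped Classical in
lemma count_split1 [Fintype F] (y : Fin 6 → F) :
    ((SS y).filter (fun a => ¬ IsDoubleLine a ∧ disc a = 0)).card =
      ((SS y).filter IsRealPair).card + ((SS y).filter IsImagPair).card := by
  rw [← Finset.card_union_of_disjoint]
  · congr 1
    ext a
    simp only [Finset.mem_union, Finset.mem_filter, ← and_or_left]
    refine and_congr_right (fun ha => ?_)
    simp only [SS, Finset.mem_filter, Finset.mem_univ, true_and] at ha
    constructor
    · rintro ⟨h1, h2⟩
      by_cases hp : ∃ l1 l2 : Fin 3 → F, a = mulLin l1 l2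
      · obtain ⟨l1, l2, rfl⟩ := hp
        rcases prod_cases _ _ ha.1 with h | h
        · exact absurd h h1
        · exact Or.inl h
      · exact Or.inr ⟨h2, hp⟩
    · rintro (h | h)
      · refine ⟨real_not_double a h, ?_⟩
        obtain ⟨l1, l2, -, -, rfl⟩ := h
        exact disc_mulLin _ _
      · exact ⟨fun hd => h.2 (double_prod a hd), h.1⟩
  · rw [Finset.disjoint_left]
    intro a h h'
    obtain ⟨-, l1, l2, -, -, h⟩ := Finset.mem_filter.mp h
    exact (Finset.mem_filter.mp h').2.2 ⟨l1, l2, h⟩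

open scoped Classical in
lemma count_split2 [Fintype F] (y : Fin 6 → F) :
    (SS y).card = ((SS y).filter IsDoubleLine).card +
      ((SS y).filter (fun a => ¬ IsDoubleLine a ∧ disc a = 0)).card +
      ((SS y).filter IsNonsingular).card := by
  have h1 := Finset.card_filter_add_card_filter_not (s := SS y) (fun a => disc a = 0)
  have h2 := Finset.card_filter_add_card_filter_not (s := (SS y).filter (fun a => disc a = 0))
    IsDoubleLine
  rw [← h1, ← h2]
  congr 2
  · congr 1
    ext a
    simp only [Finset.mem_filter]
    exact ⟨fun h => ⟨h.1.1, h.2⟩, fun h => ⟨⟨h.1, double_disc a h.2⟩, h.2⟩⟩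
  · congr 1
    ext a
    simp only [Finset.mem_filter]
    tauto
  · ext a
    simp only [Finset.mem_filter, IsNonsingular, ne_eq]

lemma smul_double (t : F) (a : Fin 6 → F) (ht : t ≠ 0) (h : IsDoubleLine a) :
    IsDoubleLine (t • a) := by
  obtain ⟨c, l, hc, hl, rfl⟩ := h
  exact ⟨t * c, l, mul_ne_zero ht hc, hl, by rw [mul_smul]⟩

lemma smul_prod (t : F) (a : Fin 6 → F)
    (h : ∃ l1 l2 : Fin 3 → F, a = mulLin l1 l2) : ∃ l1 l2 : Fin 3 → F, t • a = mulLin l1 l2 := by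
  obtain ⟨l1, l2, rfl⟩ := h
  exact ⟨l1, t • l2, by rw [mulLin_smul_right]⟩

lemma smul_real (t : F) (a : Fin 6 → F) (ht : t ≠ 0) (h : IsRealPair a) :
    IsRealPair (t • a) := by
  obtain ⟨l1, l2, h1, h2, rfl⟩ := h
  refine ⟨l1, t • l2, ?_, ?_, by rw [mulLin_smul_right]⟩
  · rintro ⟨s, hs⟩
    exact h1 ⟨t⁻¹ * s, by rw [mul_smul, ← hs, smul_smul, inv_mul_cancel₀ ht, one_smul]⟩
  · rintro ⟨s, hs⟩
    exact h2 ⟨s * t, by rw [mul_smul, ← hs]⟩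

lemma smul_imag (t : F) (a : Fin 6 → F) (ht : t ≠ 0) (h : IsImagPair a) :
    IsImagPair (t • a) := by
  refine ⟨by rw [disc_smul, h.1, mul_zero], fun hp => h.2 ?_⟩
  have := smul_prod t⁻¹ _ hp
  rwa [smul_smul, inv_mul_cancel₀ ht, one_smul] at this

lemma smul_nonsing (t : F) (a : Fin 6 → F) (ht : t ≠ 0) (h : IsNonsingular a) :
    IsNonsingular (t • a) := by
  rw [IsNonsingular, disc_smul]
  exact mul_ne_zero (pow_ne_zero 3 ht) h

open scoped Classical in
lemma numConics_SS [Fintype F] (y : Fin 6 → F) (T : (Fin 6 → F) → Prop)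
    (hT : ∀ (t : F) a, t ≠ 0 → T a → T (t • a)) :
    numConics (squab y) T * (Fintype.card F - 1) = ((SS y).filter T).card := by
  rw [numConics_mul _ _ hT, SS, Finset.filter_filter]

lemma arith (r d e i n : ℕ) (hr : 0 < r)
    (h1 : d * r = (r + 1) ^ 2 - 1)
    (h2 : ((r + 1) ^ 3 - 1) * ((r + 1) ^ 2 - 1) = d * r * r + e * r * (2 * r))
    (h3 : ((r + 1) ^ 3 - 1) * ((r + 1) ^ 2 - 1) = d * r * ((r + 1) ^ 2 - 1) + (e * r + i * r) * r)
    (h4 : (r + 1) ^ 5 - 1 = d * r + (e * r + i * r) + n * r) :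
    d = r + 1 + 1 ∧ e = ((r + 1) ^ 3 + 2 * (r + 1) ^ 2 + (r + 1)) / 2 ∧
    i = ((r + 1) ^ 3 - (r + 1)) / 2 ∧ n = (r + 1) ^ 4 := by
  have p2 : (r + 1) ^ 2 - 1 = r * (r + 2) := by
    rw [Nat.sub_eq_iff_eq_add (Nat.one_le_pow _ _ (by omega))]; ring
  have p3 : (r + 1) ^ 3 - 1 = r * (r ^ 2 + 3 * r + 3) := by
    rw [Nat.sub_eq_iff_eq_add (Nat.one_le_pow _ _ (by omega))]; ring
  have p5 : (r + 1) ^ 5 - 1 = r * (r ^ 4 + 5 * r ^ 3 + 10 * r ^ 2 + 10 * r + 5) := by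
    rw [Nat.sub_eq_iff_eq_add (Nat.one_le_pow _ _ (by omega))]; ring
  have p1 : (r + 1) ^ 3 - (r + 1) = r * (r + 1) * (r + 2) := by
    have : (r + 1) ^ 3 = r * (r + 1) * (r + 2) + (r + 1) := by ring
    omega
  rw [p2] at h1 h2 h3
  rw [p3] at h2 h3
  rw [p5] at h4
  have hd : d = r + 2 := Nat.eq_of_mul_eq_mul_right hr (by rw [h1]; ring)
  subst hd
  have he : 2 * e = (r + 1) ^ 3 + 2 * (r + 1) ^ 2 + (r + 1) := by
    have hrr : 0 < r * r := Nat.mul_pos hr hr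
    apply Nat.eq_of_mul_eq_mul_right hrr
    nlinarith [h2]
  have hi : 2 * i = r * (r + 1) * (r + 2) := by
    have hrr : 0 < r * r := Nat.mul_pos hr hr
    apply Nat.eq_of_mul_eq_mul_right hrr
    nlinarith [h3, congrArg (fun x => x * (r * r)) he]
  have hn : n = (r + 1) ^ 4 := by
    apply Nat.eq_of_mul_eq_mul_right hr
    nlinarith [h4, congrArg (fun x => x * r) he, congrArg (fun x => x * r) hi]
  refine ⟨rfl, by omega, by omega, hn⟩

end helpers

/-- conic counts of a rank-3 squab, any prime power `q`. -/
theorem squab_rank_three_conic_counts (F : Type) [Field F] [Fintype F] (q : ℕ)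
    (hq : Fintype.card F = q) (y : Fin 6 → F) (hy : y ≠ 0) (hrk : (M y).rank = 3) :
    numConics (squab y) IsDoubleLine = q + 1 ∧
    numConics (squab y) IsRealPair = (q ^ 3 + 2 * q ^ 2 + q) / 2 ∧
    numConics (squab y) IsImagPair = (q ^ 3 - q) / 2 ∧
    numConics (squab y) IsNonsingular = q ^ 4 := by

  classical
  have hdt := dt_ne y hrk
  have hq1 : 1 < Fintype.card F := Fintype.one_lt_card
  have a1 := count_double y hdt
  have a2 := count_dvd y hdt
  have a3 := count_vtx y hdt
  have a4 := count_split2 y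
  rw [count_total y hdt] at a4
  rw [count_split1] at a3 a4
  rw [← numConics_SS y _ smul_double] at a1 a2 a3 a4
  rw [← numConics_SS y _ smul_real] at a2 a3 a4
  rw [← numConics_SS y _ smul_imag] at a3 a4
  rw [← numConics_SS y _ smul_nonsing] at a4
  rw [hq] at a1 a2 a3 a4 hq1
  obtain ⟨r, rfl⟩ : ∃ r, q = r + 1 := ⟨q - 1, by omega⟩
  simp only [Nat.add_sub_cancel] at a1 a2 a3 a4
  exact arith r _ _ _ _ (by omega) a1 a2 a3 a4
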